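/- Let n be a nonzero rational number and suppose there exist rational numbers u, v with v ≠ 0 and v^2 = u^3 - n^2 u. Then there exist rational numbers x, y, z with x·y·z ≠ 0 such that x^4 + y^4 - z^4 = 2n^2. -/

import Mathlib

theorem aux_two_sq (a n : ℚ) (hn : n ≠ 0) : a ^ 2 ≠ 2 * n ^ 2 := by
  intro h
  have h2 : (a / n) ^ 2 = 2 := by field_simp; linarith
  apply irrational_sqrt_two
  refine ⟨|a / n|, ?_⟩
  have h3 : ((a / n : ℚ) : ℝ) ^ 2 = 2 := by exact_mod_cast h2
  rw [← h3, Real.sqrt_sq_eq_abs, Rat.cast_abs]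

/-- Equation (34) in the proof of Theorem 1.4: a nontrivial rational point on
`v² = u³ - n²u` represents `2n²` in the form `x⁴ + y⁴ - z⁴`. -/
theorem two_n_sq_as_x4_y4_sub_z4 (n : ℚ) (hn : n ≠ 0)
    (h : ∃ u v : ℚ, v ≠ 0 ∧ v ^ 2 = u ^ 3 - n ^ 2 * u) :
    ∃ x y z : ℚ, x * y * z ≠ 0 ∧ x ^ 4 + y ^ 4 - z ^ 4 = 2 * n ^ 2 := by
  obtain ⟨u, v, hv, h⟩ := h
  have ha : u ^ 2 - 2 * n * u - n ^ 2 ≠ 0 := fun h0 =>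
    aux_two_sq (u - n) n hn (by linarith)
  have hb : u ^ 2 + 2 * n * u - n ^ 2 ≠ 0 := fun h0 =>
    aux_two_sq (u + n) n hn (by linarith)
  have hs : u ^ 2 + n ^ 2 ≠ 0 := by positivity
  obtain ⟨s, hsd⟩ : ∃ s, s = (u ^ 2 + n ^ 2) / (2 * v) := ⟨_, rfl⟩
  obtain ⟨a, had⟩ : ∃ a, a = (u ^ 2 - 2 * n * u - n ^ 2) / (2 * v) := ⟨_, rfl⟩
  obtain ⟨b, hbd⟩ : ∃ b, b = (u ^ 2 + 2 * n * u - n ^ 2) / (2 * v) := ⟨_, rfl⟩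
  have hs0 : s ≠ 0 := by rw [hsd]; positivity
  have ha0 : a ≠ 0 := by rw [had]; exact div_ne_zero ha (by positivity)
  have hb0 : b ≠ 0 := by rw [hbd]; exact div_ne_zero hb (by positivity)
  have h1 : a ^ 2 = s ^ 2 - n := by
    rw [had, hsd]; field_simp; linear_combination 4 * n * h
  have h2 : b ^ 2 = s ^ 2 + n := by
    rw [hbd, hsd]; field_simp; linear_combination (-4) * n * h
  refine ⟨s, n / s, a * b / s, by positivity, ?_⟩
  have h3 : (a * b / s) ^ 4 = (s ^ 2 - n) ^ 2 * (s ^ 2 + n) ^ 2 / s ^ 4 := by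
    rw [← h1, ← h2]; ring
  rw [h3]; field_simp; ring
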